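/- Let φ: F → G be a morphism of deformation functors of Artin rings over a field K of characteristic zero, let (V, v) be an obstruction theory for F and (W, w) an obstruction theory for G, and let φ': V → W be a K-linear map compatible with φ, i.e. w_e(φ(ξ)) = (φ' ⊗ Id_J)(v_e(ξ)) for every small extension e: 0 → J → B → A → 0 and every ξ ∈ F(A). If (V, v) is complete, φ' is injective, and the induced map t_F → t_G on tangent spaces is surjective, then φ is smooth. -/

import Mathlib

/-- A local Artinian `K`-algebra with residue field `K` (an object of the category `Art_K`). -/
structure ArtinAlgebra (K : Type) [Field K] : Type 1 where
  carrier : Type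
  [commRing : CommRing carrier]
  [alg : Algebra K carrier]
  [artinian : IsArtinianRing carrier]
  [isLocal : IsLocalRing carrier]
  residue_bij : Function.Bijective (algebraMap K (IsLocalRing.ResidueField carrier))

attribute [instance] ArtinAlgebra.commRing ArtinAlgebra.alg ArtinAlgebra.artinian
  ArtinAlgebra.isLocal

variable {K : Type} [Field K]

namespace ArtinAlgebra

/-- The maximal ideal of a local Artinian algebra. -/
abbrev m (A : ArtinAlgebra K) : Ideal A.carrier := IsLocalRing.maximalIdeal A.carrier

/-- `P`, with projections `pB`, `pC`, is the fiber product `B ×_A C` of `β : B → A` and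
`γ : C → A` in the category of local Artinian `K`-algebras. -/
structure IsFiberProduct {A B C P : ArtinAlgebra K}
    (β : B.carrier →ₐ[K] A.carrier) (γ : C.carrier →ₐ[K] A.carrier)
    (pB : P.carrier →ₐ[K] B.carrier) (pC : P.carrier →ₐ[K] C.carrier) : Prop where
  comm : ∀ p, β (pB p) = γ (pC p)
  inj : ∀ p q, pB p = pB q → pC p = pC q → p = q
  surj : ∀ b c, β b = γ c → ∃ p, pB p = b ∧ pC p = c

/-- `A` is (isomorphic to) the base field `K` itself. -/
def IsBase (A : ArtinAlgebra K) : Prop := Function.Bijective (algebraMap K A.carrier)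

end ArtinAlgebra

/-- A functor of Artin rings: a covariant functor `Art_K → Set` with `F(K)` a point. -/
structure ArtinFunctor (K : Type) [Field K] : Type 1 where
  obj : ArtinAlgebra K → Type
  map : ∀ {A B : ArtinAlgebra K}, (A.carrier →ₐ[K] B.carrier) → obj A → obj B
  map_id : ∀ (A : ArtinAlgebra K) (x : obj A), map (AlgHom.id K A.carrier) x = x
  map_comp : ∀ {A B C : ArtinAlgebra K} (f : A.carrier →ₐ[K] B.carrier)
      (g : B.carrier →ₐ[K] C.carrier) (x : obj A), map (g.comp f) x = map g (map f x)
  obj_point : ∀ A : ArtinAlgebra K, A.IsBase → Nonempty (obj A) ∧ Subsingleton (obj A)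

namespace ArtinFunctor

variable (F : ArtinFunctor K)

/-- Surjectivity of the natural map `η : F(B ×_A C) → F(B) ×_{F(A)} F(C)`. -/
def EtaSurjective {A B C P : ArtinAlgebra K}
    (β : B.carrier →ₐ[K] A.carrier) (γ : C.carrier →ₐ[K] A.carrier)
    (pB : P.carrier →ₐ[K] B.carrier) (pC : P.carrier →ₐ[K] C.carrier) : Prop :=
  ∀ (xB : F.obj B) (xC : F.obj C), F.map β xB = F.map γ xC →
    ∃ ξ : F.obj P, F.map pB ξ = xB ∧ F.map pC ξ = xC

/-- Injectivity of the natural map `η : F(B ×_A C) → F(B) ×_{F(A)} F(C)`. -/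
def EtaInjective {A B C P : ArtinAlgebra K}
    (β : B.carrier →ₐ[K] A.carrier) (γ : C.carrier →ₐ[K] A.carrier)
    (pB : P.carrier →ₐ[K] B.carrier) (pC : P.carrier →ₐ[K] C.carrier) : Prop :=
  ∀ ξ ξ' : F.obj P, F.map pB ξ = F.map pB ξ' → F.map pC ξ = F.map pC ξ' → ξ = ξ'

/-- `F` is a deformation functor: `η` is surjective whenever `B → A` is surjective, and
bijective whenever moreover `A = K`. -/
def IsDeformationFunctor : Prop :=
  ∀ ⦃A B C P : ArtinAlgebra K⦄
    (β : B.carrier →ₐ[K] A.carrier) (γ : C.carrier →ₐ[K] A.carrier)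
    (pB : P.carrier →ₐ[K] B.carrier) (pC : P.carrier →ₐ[K] C.carrier),
    ArtinAlgebra.IsFiberProduct β γ pB pC → Function.Surjective β →
      F.EtaSurjective β γ pB pC ∧ (A.IsBase → F.EtaInjective β γ pB pC)

/-- `F` is homogeneous: `η` is bijective whenever `B → A` is surjective. -/
def IsHomogeneous : Prop :=
  ∀ ⦃A B C P : ArtinAlgebra K⦄
    (β : B.carrier →ₐ[K] A.carrier) (γ : C.carrier →ₐ[K] A.carrier)
    (pB : P.carrier →ₐ[K] B.carrier) (pC : P.carrier →ₐ[K] C.carrier),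
    ArtinAlgebra.IsFiberProduct β γ pB pC → Function.Surjective β →
      F.EtaSurjective β γ pB pC ∧ F.EtaInjective β γ pB pC

end ArtinFunctor

/-- A natural transformation (morphism) of functors of Artin rings. -/
structure ArtinNatTrans (F G : ArtinFunctor K) where
  app : ∀ A : ArtinAlgebra K, F.obj A → G.obj A
  naturality : ∀ {A B : ArtinAlgebra K} (f : A.carrier →ₐ[K] B.carrier) (x : F.obj A),
    app B (F.map f x) = G.map f (app A x)

namespace ArtinNatTrans

variable {F G : ArtinFunctor K}

/-- `φ : F → G` is smooth: `F(B) → G(B) ×_{G(A)} F(A)` is surjective for every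
surjection `B → A` in `Art_K`. -/
def IsSmooth (φ : ArtinNatTrans F G) : Prop :=
  ∀ ⦃A B : ArtinAlgebra K⦄ (f : B.carrier →ₐ[K] A.carrier), Function.Surjective f →
    ∀ (x : F.obj A) (y : G.obj B), G.map f y = φ.app A x →
      ∃ z : F.obj B, F.map f z = x ∧ φ.app B z = y

/-- `φ : F → G` is unramified: the induced map on tangent spaces
`t_F = F(K[ε]) → t_G = G(K[ε])` is injective. -/
def IsUnramified (φ : ArtinNatTrans F G) : Prop :=
  ∀ E : ArtinAlgebra K, Nonempty (E.carrier ≃ₐ[K] DualNumber K) →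
    Function.Injective (φ.app E)

/-- `φ : F → G` is étale: smooth and unramified. -/
def IsEtale (φ : ArtinNatTrans F G) : Prop := φ.IsSmooth ∧ φ.IsUnramified

end ArtinNatTrans

open scoped TensorProduct

/-- A small extension `e : 0 → J → B → A → 0` in `Art_K`: a surjection `π : B → A`
whose kernel `J` is annihilated by the maximal ideal of `B`. -/
structure SmallExtension (K : Type) [Field K] : Type 1 where
  B : ArtinAlgebra K
  A : ArtinAlgebra K
  π : B.carrier →ₐ[K] A.carrier
  surj : Function.Surjective π
  small : ∀ x ∈ B.m, ∀ y ∈ RingHom.ker π.toRingHom, x * y = 0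

namespace SmallExtension

variable {K : Type} [Field K]

/-- The kernel `J` of a small extension, viewed as a `K`-vector space. -/
def J (e : SmallExtension K) : Submodule K e.B.carrier :=
  (RingHom.ker e.π.toRingHom).restrictScalars K

/-- The kernel of a small extension is mapped into the kernel by a morphism of small
extensions. -/
theorem map_ker {e₁ e₂ : SmallExtension K}
    (φB : e₁.B.carrier →ₐ[K] e₂.B.carrier) (φA : e₁.A.carrier →ₐ[K] e₂.A.carrier)
    (hsq : e₂.π.comp φB = φA.comp e₁.π) :
    ∀ x ∈ e₁.J, φB x ∈ e₂.J := by
  intro x hx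
  have h := DFunLike.congr_fun hsq x
  simp only [AlgHom.comp_apply] at h
  simp only [J, Submodule.restrictScalars_mem, RingHom.mem_ker] at hx ⊢
  simp only [AlgHom.toRingHom_eq_coe, RingHom.coe_coe] at hx ⊢
  rw [h, hx, map_zero]

/-- The `K`-linear map `J₁ → J₂` induced by a morphism of small extensions. -/
def kerMap {e₁ e₂ : SmallExtension K}
    (φB : e₁.B.carrier →ₐ[K] e₂.B.carrier) (φA : e₁.A.carrier →ₐ[K] e₂.A.carrier)
    (hsq : e₂.π.comp φB = φA.comp e₁.π) : ↥e₁.J →ₗ[K] ↥e₂.J :=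
  (φB.toLinearMap.restrict (map_ker φB φA hsq))

end SmallExtension

/-- An obstruction theory `(V, v)` for a functor of Artin rings `F`. -/
structure ObstructionTheory {K : Type} [Field K] (F : ArtinFunctor K) : Type 1 where
  V : Type
  [acg : AddCommGroup V]
  [mod : Module K V]
  ob : ∀ e : SmallExtension K, F.obj e.A → V ⊗[K] ↥e.J
  ob_lift : ∀ (e : SmallExtension K) (ξ : F.obj e.A),
    (∃ ξ' : F.obj e.B, F.map e.π ξ' = ξ) → ob e ξ = 0
  ob_compat : ∀ (e₁ e₂ : SmallExtension K)
    (φB : e₁.B.carrier →ₐ[K] e₂.B.carrier) (φA : e₁.A.carrier →ₐ[K] e₂.A.carrier)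
    (hsq : e₂.π.comp φB = φA.comp e₁.π) (ξ : F.obj e₁.A),
    ob e₂ (F.map φA ξ) =
      LinearMap.lTensor V (SmallExtension.kerMap φB φA hsq) (ob e₁ ξ)

attribute [instance] ObstructionTheory.acg ObstructionTheory.mod

/-- An obstruction theory is complete if an element lifts exactly when its obstruction
vanishes. -/
def ObstructionTheory.IsComplete {K : Type} [Field K] {F : ArtinFunctor K}
    (O : ObstructionTheory F) : Prop :=
  ∀ (e : SmallExtension K) (ξ : F.obj e.A),
    O.ob e ξ = 0 → ∃ ξ' : F.obj e.B, F.map e.π ξ' = ξ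

namespace ArtinAlgebra

/-- The field `K` as a local Artinian `K`-algebra. -/
def base (K : Type) [Field K] : ArtinAlgebra K where
  carrier := K
  residue_bij :=
    ⟨(algebraMap K (IsLocalRing.ResidueField K)).injective, IsLocalRing.residue_surjective⟩

theorem base_isBase (K : Type) [Field K] : (base K).IsBase := Function.bijective_id

/-- The augmentation of a local Artinian algebra with residue field `K`. -/
noncomputable def augmentation (A : ArtinAlgebra K) : A.carrier →ₐ[K] K :=
  ((AlgEquiv.ofBijective (Algebra.ofId K (IsLocalRing.ResidueField A.carrier))
      A.residue_bij).symm : IsLocalRing.ResidueField A.carrier →ₐ[K] K).comp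
    (IsScalarTower.toAlgHom K A.carrier (IsLocalRing.ResidueField A.carrier))

theorem augmentation_eq_zero_iff (A : ArtinAlgebra K) (x : A.carrier) :
    A.augmentation x = 0 ↔ x ∈ A.m := by
  simp [augmentation, m, IsLocalRing.residue_eq_zero_iff]

theorem sub_augmentation_mem (A : ArtinAlgebra K) (x : A.carrier) :
    x - algebraMap K A.carrier (A.augmentation x) ∈ A.m := by
  rw [← augmentation_eq_zero_iff, map_sub, AlgHom.commutes]
  simp

theorem augmentation_surjective (A : ArtinAlgebra K) : Function.Surjective A.augmentation :=
  fun k => ⟨algebraMap K A.carrier k, by simp⟩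

theorem isNilpotent_of_mem (A : ArtinAlgebra K) {x : A.carrier} (hx : x ∈ A.m) :
    IsNilpotent x := by
  obtain ⟨n, hn⟩ := IsArtinianRing.isNilpotent_jacobson_bot (R := A.carrier)
  rw [IsLocalRing.jacobson_eq_maximalIdeal ⊥ bot_ne_top] at hn
  refine ⟨n, ?_⟩
  have h := Ideal.pow_mem_pow hx n
  rw [hn] at h
  simpa using h

/-- An Artinian `K`-algebra with an augmentation whose kernel consists of nilpotent elements is
local with residue field `K`. -/
def ofAugmentation (R : Type) [CommRing R] [Algebra K R] [IsArtinianRing R] (ε : R →ₐ[K] K)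
    (hε : ∀ x, ε x = 0 → IsNilpotent x) : ArtinAlgebra K :=
  have : Nontrivial R := ε.toRingHom.domain_nontrivial
  have hu : ∀ x, ε x ≠ 0 → IsUnit x := fun x hx => by
    have hn : IsNilpotent (x - algebraMap K R (ε x)) := hε _ (by simp)
    have h := hn.isUnit_add_left_of_commute
      ((isUnit_iff_ne_zero.mpr hx).map (algebraMap K R)) (Commute.all _ _)
    simpa using h
  have : IsLocalRing R := IsLocalRing.of_isUnit_or_isUnit_one_sub_self fun x => by
    by_cases hx : ε x = 0
    · exact Or.inr (hu _ (by simp [hx]))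
    · exact Or.inl (hu x hx)
  { carrier := R
    residue_bij := by
      refine ⟨(algebraMap K (IsLocalRing.ResidueField R)).injective, fun y => ?_⟩
      obtain ⟨x, rfl⟩ := IsLocalRing.residue_surjective y
      refine ⟨ε x, ?_⟩
      rw [IsScalarTower.algebraMap_apply K R, IsLocalRing.ResidueField.algebraMap_eq,
        ← sub_eq_zero, ← map_sub, IsLocalRing.residue_eq_zero_iff,
        IsLocalRing.mem_maximalIdeal]
      intro h
      simpa using h.map ε }

/-- The algebra of dual numbers as a local Artinian algebra. -/
noncomputable def dual (K : Type) [Field K] : ArtinAlgebra K :=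
  have : Module.Finite K (DualNumber K) := inferInstanceAs (Module.Finite K (K × K))
  have : IsArtinianRing (DualNumber K) := IsArtinianRing.of_finite K _
  ofAugmentation (DualNumber K) (TrivSqZeroExt.fstHom K K K) fun x hx => ⟨2, by
    have hx : x.fst = 0 := hx
    ext <;> simp [pow_two, hx]⟩

/-- A proper quotient of a local Artinian algebra. -/
noncomputable def quotient (B : ArtinAlgebra K) (I : Ideal B.carrier) (hI : I ≤ B.m) :
    ArtinAlgebra K :=
  ofAugmentation (B.carrier ⧸ I)
    (Ideal.Quotient.liftₐ I B.augmentation fun x hx =>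
      (B.augmentation_eq_zero_iff x).mpr (hI hx)) fun x hx => by
    obtain ⟨b, rfl⟩ := Ideal.Quotient.mk_surjective x
    exact (B.isNilpotent_of_mem ((B.augmentation_eq_zero_iff b).mp hx)).map _

theorem isArtinianRing_of_jointly_injective {P B C : Type} [CommRing P] [CommRing B] [CommRing C]
    [IsArtinianRing B] [IsArtinianRing C] (f : P →+* B) (g : P →+* C)
    (hf : Function.Surjective f) (hg : Function.Surjective g)
    (hfg : ∀ p, f p = 0 → g p = 0 → p = 0) : IsArtinianRing P := by
  let _ : Algebra P B := f.toAlgebra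
  let _ : Algebra P C := g.toAlgebra
  have : IsArtinian P B := isArtinian_of_surjective_algebraMap hf
  have : IsArtinian P C := isArtinian_of_surjective_algebraMap hg
  refine isArtinian_of_injective ((Algebra.linearMap P B).prod (Algebra.linearMap P C)) ?_
  refine (injective_iff_map_eq_zero _).mpr fun p hp => ?_
  exact hfg p (congrArg Prod.fst hp) (congrArg Prod.snd hp)

/-- The carrier of the fiber product `B ×_K K[ε]`. -/
noncomputable abbrev tangentSubalgebra (B : ArtinAlgebra K) : Subalgebra K (B.carrier × DualNumber K) :=
  AlgHom.equalizer (B.augmentation.comp (AlgHom.fst K _ _))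
    ((TrivSqZeroExt.fstHom K K K).comp (AlgHom.snd K _ _))

theorem tangentSubalgebra_comm (B : ArtinAlgebra K) (p : B.tangentSubalgebra) :
    B.augmentation p.1.1 = p.1.2.fst := p.2

/-- The fiber product `B ×_K K[ε]`. -/
noncomputable def tangentProduct (B : ArtinAlgebra K) : ArtinAlgebra K :=
  have : IsArtinianRing B.tangentSubalgebra := by
    have : IsArtinianRing (DualNumber K) := (dual K).artinian
    refine isArtinianRing_of_jointly_injective
      ((AlgHom.fst K _ _).comp B.tangentSubalgebra.val).toRingHom
      ((AlgHom.snd K _ _).comp B.tangentSubalgebra.val).toRingHom ?_ ?_ ?_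
    · exact fun b => ⟨⟨(b, TrivSqZeroExt.inl (B.augmentation b)), rfl⟩, rfl⟩
    · intro e
      obtain ⟨b, hb⟩ := B.augmentation_surjective e.fst
      exact ⟨⟨(b, e), hb⟩, rfl⟩
    · exact fun p h₁ h₂ => Subtype.ext (Prod.ext h₁ h₂)
  ofAugmentation B.tangentSubalgebra
    (B.augmentation.comp ((AlgHom.fst K _ _).comp B.tangentSubalgebra.val)) fun p hp => by
    obtain ⟨n, hn⟩ := B.isNilpotent_of_mem ((B.augmentation_eq_zero_iff _).mp hp)
    have h0 : p.1.2.fst = 0 := (B.tangentSubalgebra_comm p).symm.trans hp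
    have hn' : p.1.1 ^ n = 0 := hn
    refine ⟨n + 2, Subtype.ext (Prod.ext ?_ ?_)⟩
    · change p.1.1 ^ (n + 2) = 0
      rw [pow_add, hn', zero_mul]
    · change p.1.2 ^ (n + 2) = 0
      have : p.1.2 ^ 2 = 0 := by ext <;> simp [pow_two, h0]
      rw [pow_add, this, mul_zero]

/-- The projection `B ×_K K[ε] → B`. -/
noncomputable def tangentFst (B : ArtinAlgebra K) : B.tangentProduct.carrier →ₐ[K] B.carrier :=
  (AlgHom.fst K _ _).comp B.tangentSubalgebra.val

/-- The projection `B ×_K K[ε] → K[ε]`. -/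
noncomputable def tangentSnd (B : ArtinAlgebra K) :
    B.tangentProduct.carrier →ₐ[K] (dual K).carrier :=
  (AlgHom.snd K B.carrier (DualNumber K)).comp B.tangentSubalgebra.val

theorem tangentProduct_isFiberProduct (B : ArtinAlgebra K) :
    IsFiberProduct (A := base K) (C := dual K) B.augmentation (TrivSqZeroExt.fstHom K K K)
      B.tangentFst B.tangentSnd where
  comm p := B.tangentSubalgebra_comm p
  inj _ _ h₁ h₂ := Subtype.ext (Prod.ext h₁ h₂)
  surj b e h := ⟨⟨(b, e), h⟩, rfl, rfl⟩

theorem mul_eq_augmentation_smul (B : ArtinAlgebra K) {t : B.carrier}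
    (ht : ∀ x ∈ B.m, x * t = 0) (b : B.carrier) : b * t = B.augmentation b • t := by
  rw [Algebra.smul_def, ← sub_eq_zero, ← sub_mul]
  exact ht _ (B.sub_augmentation_mem b)

/-- The homomorphism `B ×_K K[ε] → B`, `(b, a + c ε) ↦ b + c t`, for `t` in the maximal ideal
annihilated by the maximal ideal. -/
noncomputable def tangentAdd (B : ArtinAlgebra K) (t : B.carrier) (htm : t ∈ B.m)
    (ht : ∀ x ∈ B.m, x * t = 0) : B.tangentProduct.carrier →ₐ[K] B.carrier :=
  AlgHom.ofLinearMap (A := B.tangentSubalgebra)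
    { toFun := fun p => p.1.1 + p.1.2.snd • t
      map_add' := fun p q => by simp [add_smul]; ring
      map_smul' := fun k p => by
        change k • p.1.1 + (k • p.1.2).snd • t = k • (p.1.1 + p.1.2.snd • t)
        simp [mul_smul] }
    (by simp)
    (fun p q => by
      have hp := B.mul_eq_augmentation_smul ht p.1.1
      have hq := B.mul_eq_augmentation_smul ht q.1.1
      rw [B.tangentSubalgebra_comm] at hp hq
      have htt := ht t htm
      simp [Algebra.smul_def] at hp hq ⊢
      linear_combination (-algebraMap K B.carrier q.1.2.snd) * hp -
        algebraMap K B.carrier p.1.2.snd * hq -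
        algebraMap K B.carrier p.1.2.snd * algebraMap K B.carrier q.1.2.snd * htt)

theorem tangentAdd_apply (B : ArtinAlgebra K) (t : B.carrier) (htm : t ∈ B.m)
    (ht : ∀ x ∈ B.m, x * t = 0) (p : B.tangentProduct.carrier) :
    B.tangentAdd t htm ht p = B.tangentFst p + (TrivSqZeroExt.snd (B.tangentSnd p) : K) • t := rfl

/-- If the kernel of `f : B → A` is the line spanned by `t`, then `B ×_A B ≅ B ×_K K[ε]`. -/
theorem tangentAdd_isFiberProduct {A B : ArtinAlgebra K} (f : B.carrier →ₐ[K] A.carrier)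
    (t : B.carrier) (htm : t ∈ B.m) (ht : ∀ x ∈ B.m, x * t = 0) (ht0 : t ≠ 0) (hft : f t = 0)
    (hker : ∀ b, f b = 0 → ∃ k : K, b = k • t) :
    IsFiberProduct f f B.tangentFst (B.tangentAdd t htm ht) where
  comm p := by rw [tangentAdd_apply, map_add, map_smul, hft, smul_zero, add_zero]
  inj p q h₁ h₂ := by
    rw [tangentAdd_apply, tangentAdd_apply, h₁] at h₂
    have h₃ := smul_left_injective K ht0 (add_left_cancel h₂)
    refine B.tangentProduct_isFiberProduct.inj p q h₁ (TrivSqZeroExt.ext ?_ h₃)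
    have hp := B.tangentProduct_isFiberProduct.comm p
    have hq := B.tangentProduct_isFiberProduct.comm q
    rw [h₁] at hp
    exact hp.symm.trans hq
  surj b c h := by
    obtain ⟨k, hk⟩ := hker (c - b) (by rw [map_sub, h, sub_self])
    refine ⟨⟨(b, TrivSqZeroExt.inl (B.augmentation b) + TrivSqZeroExt.inr k), ?_⟩, rfl, ?_⟩
    · simp [AlgHom.mem_equalizer]
    · change b + (TrivSqZeroExt.snd (TrivSqZeroExt.inl (B.augmentation b) +
        TrivSqZeroExt.inr k : DualNumber K)) • t = c
      simp [← hk]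

end ArtinAlgebra

/-- The lifting property of `φ` along a single homomorphism `f : B → A`. -/
def ArtinNatTrans.LiftsAlong {F G : ArtinFunctor K} (φ : ArtinNatTrans F G)
    {A B : ArtinAlgebra K} (f : B.carrier →ₐ[K] A.carrier) : Prop :=
  ∀ (x : F.obj A) (y : G.obj B), G.map f y = φ.app A x →
    ∃ z : F.obj B, F.map f z = x ∧ φ.app B z = y

namespace ArtinNatTrans

variable {F G : ArtinFunctor K}

theorem liftsAlong_comp (φ : ArtinNatTrans F G) {A B C : ArtinAlgebra K}
    {f : B.carrier →ₐ[K] A.carrier} {g : C.carrier →ₐ[K] B.carrier}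
    (hf : φ.LiftsAlong f) (hg : φ.LiftsAlong g) : φ.LiftsAlong (f.comp g) := by
  intro x y hxy
  rw [G.map_comp] at hxy
  obtain ⟨z, hz, hz'⟩ := hf x _ hxy
  obtain ⟨w, hw, hw'⟩ := hg z y hz'.symm
  exact ⟨w, by rw [F.map_comp, hw, hz], hw'⟩

theorem liftsAlong_of_bijective (φ : ArtinNatTrans F G) {A B : ArtinAlgebra K}
    (f : B.carrier →ₐ[K] A.carrier) (hf : Function.Bijective f) : φ.LiftsAlong f := by
  intro x y hxy
  let e := AlgEquiv.ofBijective f hf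
  have h₁ : f.comp (e.symm : A.carrier →ₐ[K] B.carrier) = AlgHom.id K _ :=
    AlgHom.ext e.apply_symm_apply
  have h₂ : (e.symm : A.carrier →ₐ[K] B.carrier).comp f = AlgHom.id K _ :=
    AlgHom.ext e.symm_apply_apply
  refine ⟨F.map (e.symm : A.carrier →ₐ[K] B.carrier) x, ?_, ?_⟩
  · rw [← F.map_comp, h₁, F.map_id]
  · rw [φ.naturality, ← hxy, ← G.map_comp, h₂, G.map_id]

/-- Lifting along a surjection of algebras whose kernel is a line annihilated by the maximal
ideal, when every element lifting over `G` also lifts over `F`. -/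
theorem liftsAlong_of_ker_line (φ : ArtinNatTrans F G)
    (hF : F.IsDeformationFunctor) (hG : G.IsDeformationFunctor)
    (htangent : ∀ E : ArtinAlgebra K, Nonempty (E.carrier ≃ₐ[K] DualNumber K) →
      Function.Surjective (φ.app E))
    {A B : ArtinAlgebra K} (f : B.carrier →ₐ[K] A.carrier) (hf : Function.Surjective f)
    (hlift : ∀ x : F.obj A, (∃ y : G.obj B, G.map f y = φ.app A x) → ∃ z, F.map f z = x)
    (t : B.carrier) (ht : ∀ x ∈ B.m, x * t = 0) (ht0 : t ≠ 0) (hft : f t = 0)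
    (hker : ∀ b, f b = 0 → ∃ k : K, b = k • t) : φ.LiftsAlong f := by
  intro x y hxy
  have htm : t ∈ B.m := (IsLocalRing.mem_maximalIdeal _).mpr fun h => by
    simpa [hft] using h.map f
  obtain ⟨x', hx'⟩ := hlift x ⟨y, hxy⟩
  have hfib := ArtinAlgebra.tangentAdd_isFiberProduct f t htm ht ht0 hft hker
  have htan := B.tangentProduct_isFiberProduct
  obtain ⟨η, hη₁, hη₂⟩ := (hG f f _ _ hfib hf).1 (φ.app B x') y
    (by rw [← φ.naturality, hx', hxy])
  obtain ⟨σ, hσ⟩ := htangent (ArtinAlgebra.dual K) ⟨AlgEquiv.refl⟩ (G.map B.tangentSnd η)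
  obtain ⟨ξ, hξ₁, hξ₂⟩ := (hF _ _ _ _ htan B.augmentation_surjective).1 x' σ
    ((F.obj_point _ (ArtinAlgebra.base_isBase K)).2.elim _ _)
  have hξη : φ.app _ ξ = η := by
    refine (hG _ _ _ _ htan B.augmentation_surjective).2 (ArtinAlgebra.base_isBase K) _ _ ?_ ?_
    · rw [← φ.naturality, hξ₁, hη₁]
    · rw [← φ.naturality, hξ₂, hσ]
  refine ⟨F.map (B.tangentAdd t htm ht) ξ, ?_, ?_⟩
  · have hcomm : f.comp (B.tangentAdd t htm ht) = f.comp B.tangentFst :=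
      AlgHom.ext fun p => (hfib.comm p).symm
    rw [← F.map_comp, hcomm, F.map_comp, hξ₁, hx']
  · rw [φ.naturality, hξη, hη₂]

/-- A morphism is smooth if it has the lifting property for surjections whose kernel is a line
annihilated by the maximal ideal. -/
theorem isSmooth_of_ker_line (φ : ArtinNatTrans F G)
    (h : ∀ ⦃A B : ArtinAlgebra K⦄ (f : B.carrier →ₐ[K] A.carrier), Function.Surjective f →
      ∀ t : B.carrier, (∀ x ∈ B.m, x * t = 0) → t ≠ 0 → f t = 0 →
        (∀ b, f b = 0 → ∃ k : K, b = k • t) → φ.LiftsAlong f) : φ.IsSmooth := by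
  intro A B f hf
  change φ.LiftsAlong f
  induction hI : RingHom.ker f using WellFoundedLT.induction generalizing A with
  | ind I ih =>
  by_cases hbot : I = ⊥
  · exact φ.liftsAlong_of_bijective f
      ⟨(RingHom.injective_iff_ker_eq_bot f).mpr (hI.trans hbot), hf⟩
  obtain ⟨N, hN, hmax⟩ := WellFounded.has_min (wellFounded_gt (α := Ideal B.carrier))
    {N | N < I} ⟨⊥, bot_lt_iff_ne_bot.mpr hbot⟩
  replace hN : N < I := hN
  have hcov : ∀ L, N ≤ L → L ≤ I → L ≠ N → L = I := fun L h₁ h₂ h₃ => by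
    by_contra h₄
    exact hmax L (lt_of_le_of_ne h₂ h₄) (lt_of_le_of_ne h₁ h₃.symm)
  have hIm : I ≤ B.m := by
    rw [← hI]
    exact IsLocalRing.le_maximalIdeal (RingHom.ker_ne_top _)
  have hmI : B.m • I ≤ N := by
    by_contra hle
    have hsup := hcov (N ⊔ B.m • I) le_sup_left (sup_le hN.le Submodule.smul_le_right)
      fun h' => hle (h' ▸ le_sup_right)
    refine hN.not_ge (Submodule.le_of_le_smul_of_le_jacobson_bot (I := B.m)
      (IsNoetherian.noetherian I) ?_ hsup.ge)
    rw [IsLocalRing.jacobson_eq_maximalIdeal ⊥ bot_ne_top]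
  obtain ⟨t, htI, htN⟩ := SetLike.exists_of_lt hN
  have hspan : N ⊔ Ideal.span {t} = I :=
    hcov _ le_sup_left (sup_le hN.le ((Ideal.span_singleton_le_iff_mem _).mpr htI)) fun h' =>
      htN (h' ▸ Ideal.mem_sup_right (Ideal.mem_span_singleton_self t))
  have hfI : ∀ b, f b = 0 ↔ b ∈ I := fun b => by rw [← hI]; rfl
  let C := B.quotient N (hN.le.trans hIm)
  let q : B.carrier →ₐ[K] C.carrier := Ideal.Quotient.mkₐ K N
  have hq : Function.Surjective q := Ideal.Quotient.mk_surjective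
  have hq0 : ∀ b, q b = 0 ↔ b ∈ N := fun b => Ideal.Quotient.eq_zero_iff_mem
  let g : C.carrier →ₐ[K] A.carrier :=
    Ideal.Quotient.liftₐ N f fun b hb => (hfI b).mpr (hN.le hb)
  have hgq : g.comp q = f := Ideal.Quotient.liftₐ_comp _ _ _
  have hgq' : ∀ b, g (q b) = f b := fun b => DFunLike.congr_fun hgq b
  rw [← hgq]
  refine φ.liftsAlong_comp (h g ?_ (q t) ?_ ?_ ?_ ?_) (ih N hN q hq ?_)
  · exact fun a => (hf a).imp' q fun b hb => (hgq' b).trans hb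
  · intro x hx
    obtain ⟨b, rfl⟩ := hq x
    have hb : b ∈ B.m := (IsLocalRing.mem_maximalIdeal _).mpr fun hb =>
      (IsLocalRing.mem_maximalIdeal _).mp hx (hb.map q)
    rw [← map_mul, hq0]
    exact hmI (Submodule.smul_mem_smul hb htI)
  · rwa [Ne, hq0]
  · rw [hgq', hfI]
    exact htI
  · intro c hc
    obtain ⟨b, rfl⟩ := hq c
    rw [hgq', hfI, ← hspan] at hc
    obtain ⟨n, hn, s, hs, rfl⟩ := Submodule.mem_sup.mp hc
    obtain ⟨r, rfl⟩ := Ideal.mem_span_singleton'.mp hs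
    refine ⟨B.augmentation r, ?_⟩
    rw [← map_smul, ← sub_eq_zero, ← map_sub, hq0, add_sub_assoc, Algebra.smul_def, ← sub_mul]
    exact N.add_mem hn (hmI (Submodule.smul_mem_smul (B.sub_augmentation_mem r) htI))
  · ext b
    exact hq0 b

end ArtinNatTrans

/-- **standard smoothness criterion.**  Let `φ : F → G` be a morphism of
deformation functors, `(V, v)` an obstruction theory for `F`, `(W, w)` an obstruction
theory for `G`, and `φ' : V → W` a `K`-linear map compatible with `φ`.  If `(V, v)` is
complete, `φ'` is injective and `t_F → t_G` is surjective, then `φ` is smooth. -/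
theorem smooth_of_complete_obstruction {K : Type} [Field K] [CharZero K]
    {F G : ArtinFunctor K} (φ : ArtinNatTrans F G)
    (hF : F.IsDeformationFunctor) (hG : G.IsDeformationFunctor)
    (OF : ObstructionTheory F) (OG : ObstructionTheory G)
    (φ' : OF.V →ₗ[K] OG.V)
    (hcompat : ∀ (e : SmallExtension K) (ξ : F.obj e.A),
      OG.ob e (φ.app e.A ξ) = LinearMap.rTensor ↥e.J φ' (OF.ob e ξ))
    (hcomplete : OF.IsComplete)
    (hinj : Function.Injective φ')
    (htangent : ∀ E : ArtinAlgebra K, Nonempty (E.carrier ≃ₐ[K] DualNumber K) →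
      Function.Surjective (φ.app E)) :
    φ.IsSmooth := by
  refine φ.isSmooth_of_ker_line fun A B f hf t ht ht0 hft hker =>
    φ.liftsAlong_of_ker_line hF hG htangent f hf ?_ t ht ht0 hft hker
  intro x hx
  let e : SmallExtension K :=
    { B := B
      A := A
      π := f
      surj := hf
      small := fun b hb c hc => by
        obtain ⟨k, rfl⟩ := hker c hc
        rw [mul_smul_comm, ht b hb, smul_zero] }
  refine hcomplete e x
    (Module.Flat.rTensor_preserves_injective_linearMap (M := e.J) φ' hinj ?_)
  rw [← hcompat, map_zero]
  exact OG.ob_lift e _ hx
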